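/- arXiv:2406.14700 — 2 statements merged into one kernel-verified Lean document; each statement's English description precedes it below -/
import Mathlib

section
/- On the interval [1/2, 1], the sequence of functions s_n(p) converges uniformly to a limit function s(p); in particular, s is continuous on [1/2, 1]. -/
/-- `v p n` is the optimal expected number of heads in the coin game with `n` coins,
each landing heads with probability `p`. -/
noncomputable def v (p : ℝ) : ℕ → ℝ
  | 0 => 0
  | n + 1 =>
      ((n : ℝ) + 1) * p ^ (n + 1) + v p n * (1 - p) ^ (n + 1) +
        ∑ j ∈ (Finset.Icc 1 n).attach,
          (((n + 1).choose j.1 : ℕ) : ℝ) * p ^ (j.1 : ℕ) * (1 - p) ^ (n + 1 - j.1) *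
            ((Finset.Icc 1 j.1).attach.sup'
              (Finset.attach_nonempty_iff.mpr
                (Finset.nonempty_Icc.mpr (Finset.mem_Icc.mp j.2).1))
              (fun i => v p (n + 1 - i.1) + (i.1 : ℝ)))
decreasing_by
  · omega
  · have h := (Finset.mem_Icc.mp i.2).1
    omega

/-- `s p n = v p n - n + 1 - p`. -/
noncomputable def s (p : ℝ) (n : ℕ) : ℝ := v p n - n + 1 - p

open Filter Topology

lemma sum_Icc_choose_mul_pow (x y : ℝ) (n : ℕ) :
    ∑ j ∈ Finset.Icc 1 n, ((n + 1).choose j : ℝ) * x ^ j * y ^ (n + 1 - j) =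
      (x + y) ^ (n + 1) - x ^ (n + 1) - y ^ (n + 1) := by
  have hrange : Finset.Icc 1 n = Finset.Ico 1 (n + 1) := by
    ext j
    simp only [Finset.mem_Icc, Finset.mem_Ico]
    omega
  rw [add_pow, Finset.sum_range_succ, Finset.range_eq_Ico,
    Finset.sum_eq_sum_Ico_succ_bot (Nat.succ_pos n), hrange]
  simp only [pow_zero, Nat.sub_zero, Nat.choose_zero_right, Nat.sub_self, Nat.choose_self,
    Nat.cast_one, mul_one, one_mul, zero_add]
  rw [Finset.sum_congr rfl fun j _ =>
    (by ring : ((n + 1).choose j : ℝ) * x ^ j * y ^ (n + 1 - j) =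
      x ^ j * y ^ (n + 1 - j) * ((n + 1).choose j : ℝ))]
  ring

lemma v_succ_le {p : ℝ} (hp0 : 0 ≤ p) (hp1 : p ≤ 1) (n : ℕ) (c : ℕ → ℝ)
    (hc : ∀ j ∈ Finset.Icc 1 n, ∀ i ∈ Finset.Icc 1 j, v p (n + 1 - i) + i ≤ c j) :
    v p (n + 1) ≤ ((n : ℝ) + 1) * p ^ (n + 1) + v p n * (1 - p) ^ (n + 1) +
      ∑ j ∈ Finset.Icc 1 n, ((n + 1).choose j : ℝ) * p ^ j * (1 - p) ^ (n + 1 - j) * c j := by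
  have hq : 0 ≤ 1 - p := by linarith
  rw [v, ← Finset.sum_attach (Finset.Icc 1 n)]
  gcongr with j
  exact Finset.sup'_le _ _ fun i _ => hc j.1 j.2 i.1 i.2

lemma le_v_succ {p : ℝ} (hp0 : 0 ≤ p) (hp1 : p ≤ 1) (n : ℕ) :
    ((n : ℝ) + 1) * p ^ (n + 1) + v p n * (1 - p) ^ (n + 1) +
      (1 - p ^ (n + 1) - (1 - p) ^ (n + 1)) * (v p n + 1) ≤ v p (n + 1) := by
  have hq : 0 ≤ 1 - p := by linarith
  have hsum := sum_Icc_choose_mul_pow p (1 - p) n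
  rw [add_sub_cancel, one_pow] at hsum
  rw [v, ← hsum, Finset.sum_mul, ← Finset.sum_attach (Finset.Icc 1 n)]
  gcongr with j
  refine (le_of_eq ?_).trans (Finset.le_sup' _ (Finset.mem_attach _
    ⟨1, Finset.mem_Icc.mpr ⟨le_rfl, (Finset.mem_Icc.mp j.2).1⟩⟩))
  simp

lemma v_le {p : ℝ} (hp0 : 0 ≤ p) (hp1 : p ≤ 1) (n : ℕ) : v p n ≤ n := by
  induction n using Nat.strong_induction_on with
  | _ n ih =>
    cases n with
    | zero => simp [v]
    | succ n =>
      have hq : 0 ≤ (1 - p) ^ (n + 1) := pow_nonneg (by linarith) _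
      have h := v_succ_le hp0 hp1 n (fun _ => (n : ℝ) + 1) (by
        intro j hj i hi
        simp only [Finset.mem_Icc] at hj hi
        have h := ih (n + 1 - i) (by omega)
        rw [Nat.cast_sub (by omega)] at h
        push_cast at h
        linarith)
      rw [← Finset.sum_mul, sum_Icc_choose_mul_pow, add_sub_cancel, one_pow] at h
      have := mul_le_mul_of_nonneg_right (ih n (by omega)) hq
      push_cast
      linarith

/-- The deficit `n - v p n` increases by at most `(1 - p) ^ (n + 1)` when a coin is added. -/
lemma v_add_one_sub_le {p : ℝ} (hp0 : 0 ≤ p) (hp1 : p ≤ 1) (n : ℕ) :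
    v p n + 1 - (1 - p) ^ (n + 1) ≤ v p (n + 1) := by
  have h := le_v_succ hp0 hp1 n
  have := mul_nonneg (sub_nonneg.mpr (v_le hp0 hp1 n)) (pow_nonneg hp0 (n + 1))
  linarith

lemma v_add_le {p : ℝ} (hp : 1 / 2 ≤ p) (hp1 : p ≤ 1) (m k : ℕ) :
    v p m + k ≤ v p (m + k) + 2 * (1 - p) ^ (m + 1) - 2 * (1 - p) ^ (m + k + 1) := by
  induction k with
  | zero => simp
  | succ k ih =>
    have h := v_add_one_sub_le (by linarith) hp1 (m + k)
    have hq : 0 ≤ (1 - p) ^ (m + k + 1) := pow_nonneg (by linarith) _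
    have hpow : (1 - p) ^ (m + k + 1 + 1) ≤ (1 - p) ^ (m + k + 1) * (1 / 2) := by
      rw [pow_succ]
      gcongr
      linarith
    rw [← Nat.add_assoc]
    push_cast
    linarith

lemma sub_two_mul_le_v {p : ℝ} (hp : 1 / 2 ≤ p) (hp1 : p ≤ 1) (n : ℕ) :
    (n : ℝ) - 2 * (1 - p) ≤ v p n := by
  have h := v_add_le hp hp1 0 n
  have hq : 0 ≤ (1 - p) ^ (0 + n + 1) := pow_nonneg (by linarith) _
  simp only [v, zero_add, pow_one] at h hq
  linarith

lemma v_succ_le_add {p : ℝ} (hp : 1 / 2 ≤ p) (hp1 : p ≤ 1) (n : ℕ) :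
    v p (n + 1) ≤ v p n + 1 + 4 * (1 - p * (1 - p)) ^ (n + 1) := by
  have hp0 : 0 ≤ p := by linarith
  have hq : 0 ≤ 1 - p := by linarith
  have h := v_succ_le hp0 hp1 n (fun j => v p n + 1 + 2 * (1 - p) ^ (n + 1 - j)) (by
    intro j hj i hi
    simp only [Finset.mem_Icc] at hj hi
    have h := v_add_le hp hp1 (n + 1 - i) (i - 1)
    rw [show n + 1 - i + (i - 1) = n by omega, Nat.cast_sub hi.1] at h
    push_cast at h
    have hpow : (1 - p) ^ (n + 1 - i + 1) ≤ (1 - p) ^ (n + 1 - j) :=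
      pow_le_pow_of_le_one hq (by linarith) (by omega)
    have := pow_nonneg hq (n + 1)
    linarith)
  have hsum : ∑ j ∈ Finset.Icc 1 n, ((n + 1).choose j : ℝ) * p ^ j * (1 - p) ^ (n + 1 - j) *
      (v p n + 1 + 2 * (1 - p) ^ (n + 1 - j)) =
      (1 - p ^ (n + 1) - (1 - p) ^ (n + 1)) * (v p n + 1) +
        2 * ((1 - p * (1 - p)) ^ (n + 1) - p ^ (n + 1) - ((1 - p) * (1 - p)) ^ (n + 1)) := by
    have h₁ := sum_Icc_choose_mul_pow p (1 - p) n
    have h₂ := sum_Icc_choose_mul_pow p ((1 - p) * (1 - p)) n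
    rw [add_sub_cancel, one_pow] at h₁
    rw [show p + (1 - p) * (1 - p) = 1 - p * (1 - p) by ring] at h₂
    rw [← h₁, ← h₂, Finset.sum_mul, Finset.mul_sum, ← Finset.sum_add_distrib]
    refine Finset.sum_congr rfl fun j _ => ?_
    rw [mul_pow]
    ring
  rw [hsum] at h
  have hpow : p ^ (n + 1) ≤ (1 - p * (1 - p)) ^ (n + 1) :=
    pow_le_pow_left₀ hp0 (by nlinarith) _
  have hdef := mul_le_mul_of_nonneg_right
    (show (n : ℝ) - v p n ≤ 1 by linarith [sub_two_mul_le_v hp hp1 n])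
    (pow_nonneg hp0 (n + 1))
  have := pow_nonneg hq (n + 1)
  have := pow_nonneg (mul_nonneg hq hq) (n + 1)
  have := pow_nonneg hp0 (n + 1)
  linarith

lemma dist_s_succ_le {p : ℝ} (hp : 1 / 2 ≤ p) (hp1 : p ≤ 1) (n : ℕ) :
    dist (s p n) (s p (n + 1)) ≤ 4 * (1 - p * (1 - p)) ^ n := by
  have hr0 : 0 ≤ 1 - p * (1 - p) := by nlinarith
  have hr1 : 1 - p * (1 - p) ≤ 1 := by nlinarith
  have hpow := pow_le_pow_of_le_one hr0 hr1 n.le_succ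
  have hqpow : (1 - p) ^ (n + 1) ≤ (1 - p * (1 - p)) ^ (n + 1) :=
    pow_le_pow_left₀ (by linarith) (by nlinarith) _
  have hpos := pow_nonneg hr0 n
  have hlow := v_add_one_sub_le (by linarith) hp1 n
  have hup := v_succ_le_add hp hp1 n
  rw [Nat.succ_eq_add_one] at hpow
  rw [Real.dist_eq, abs_le]
  simp only [s]
  push_cast
  constructor <;> linarith

lemma abs_s_le {p : ℝ} (hp : 1 / 2 ≤ p) (hp1 : p ≤ 1) (n : ℕ) : |s p n| ≤ 1 - p := by
  have := v_le (by linarith) hp1 n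
  have := sub_two_mul_le_v hp hp1 n
  rw [abs_le]
  simp only [s]
  constructor <;> linarith

lemma exists_tendsto_s {p : ℝ} (hp : 1 / 2 ≤ p) (hp1 : p ≤ 1) :
    ∃ l, Tendsto (s p) atTop (𝓝 l) := by
  rcases hp1.eq_or_lt with rfl | hlt
  · refine ⟨0, tendsto_const_nhds.congr fun n => ?_⟩
    have := abs_s_le hp le_rfl n
    exact (abs_nonpos_iff.mp (by linarith)).symm
  · exact cauchySeq_tendsto_of_complete
      (cauchySeq_of_le_geometric (1 - p * (1 - p)) 4 (by nlinarith) (dist_s_succ_le hp hp1))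

lemma continuous_v (n : ℕ) : Continuous fun p => v p n := by
  induction n using Nat.strong_induction_on with
  | _ n ih =>
    cases n with
    | zero => simpa only [v] using continuous_const
    | succ n =>
      simp only [v]
      have hn := ih n (by omega)
      refine Continuous.add (by fun_prop) (continuous_finsetSum _ fun j _ => ?_)
      refine Continuous.mul (by fun_prop) (Continuous.finset_sup'_apply _ fun i _ => ?_)
      have hi := Finset.mem_Icc.mp i.2
      exact (ih _ (by omega)).add continuous_const

lemma tendstoUniformlyOn_s {S : ℝ → ℝ}
    (hS : ∀ p ∈ Set.Icc (1 / 2 : ℝ) 1, Tendsto (s p) atTop (𝓝 (S p))) :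
    TendstoUniformlyOn (fun (n : ℕ) (p : ℝ) => s p n) S atTop (Set.Icc (1 / 2 : ℝ) 1) := by
  rw [Metric.tendstoUniformlyOn_iff]
  intro ε hε
  obtain ⟨δ, hδ0, hδ1, hδε⟩ : ∃ δ : ℝ, 0 < δ ∧ δ ≤ 1 ∧ 2 * δ < ε :=
    ⟨min 1 (ε / 3), by positivity, min_le_left _ _, by linarith [min_le_right 1 (ε / 3)]⟩
  have hlim : Tendsto (fun n : ℕ => 4 * (1 - δ / 2) ^ n / (δ / 2)) atTop (𝓝 0) := by
    simpa using ((tendsto_pow_atTop_nhds_zero_of_lt_one (r := 1 - δ / 2)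
      (by linarith) (by linarith)).const_mul 4).div_const (δ / 2)
  filter_upwards [hlim.eventually (gt_mem_nhds hε)] with n hn p hp
  rw [dist_comm]
  rcases le_total (1 - p) δ with hpδ | hpδ
  · have hSp : |S p| ≤ 1 - p := le_of_tendsto (hS p hp).abs
      (Eventually.of_forall (abs_s_le hp.1 hp.2))
    rw [Real.dist_eq]
    linarith [abs_sub (s p n) (S p), abs_s_le hp.1 hp.2 n]
  · have hpq : δ / 2 ≤ p * (1 - p) := by nlinarith [hp.1]
    refine lt_of_le_of_lt ?_ hn
    refine (dist_le_of_le_geometric_of_tendsto (1 - p * (1 - p)) 4 (by linarith)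
      (dist_s_succ_le hp.1 hp.2) (hS p hp) n).trans ?_
    rw [sub_sub_cancel]
    have : 0 ≤ 1 - p * (1 - p) := by nlinarith [hp.1]
    have : 0 ≤ 1 - δ / 2 := by linarith
    gcongr

theorem coin_game_uniform_convergence :
    ∃ S : ℝ → ℝ,
      TendstoUniformlyOn (fun (n : ℕ) (p : ℝ) => s p n) S Filter.atTop
        (Set.Icc (1 / 2 : ℝ) 1) ∧
      ContinuousOn S (Set.Icc (1 / 2 : ℝ) 1) := by
  choose! S hS using fun (p : ℝ) (hp : p ∈ Set.Icc (1 / 2 : ℝ) 1) => exists_tendsto_s hp.1 hp.2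
  have hunif := tendstoUniformlyOn_s hS
  refine ⟨S, hunif, hunif.continuousOn (Eventually.of_forall fun n => ?_).frequently⟩
  have := continuous_v n
  simp only [s]
  fun_prop
end

section
/- There exists a unique real number p_0 ∈ [1/2, 1) with s(p_0) = 0; moreover s(p) < 0 for all p with 1/2 ≤ p < p_0, s(p) > 0 for all p with p_0 < p < 1, and 0.5495021777642 ≤ p_0 ≤ 0.54950217776421. -/
namespace CoinGame

open Finset Filter Topology

/-! ### Probability of at most one tail, and drift -/

/-- The probability that `k + 2` coins show at most one tail. -/
def tailProb {K : Type*} [Field K] (p : K) (k : ℕ) : K :=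
  ((k : K) + 2) * p ^ (k + 1) - ((k : K) + 1) * p ^ (k + 2)

/-- The inhomogeneous term of the linearised recursion for `s`. -/
def drift {K : Type*} [Field K] (p : K) (k : ℕ) : K :=
  p ^ (k + 2) * (1 - p) - (1 - p) ^ (k + 2)

lemma monotoneOn_tailProb (k : ℕ) :
    MonotoneOn (fun p : ℝ => tailProb p k) (Set.Icc 0 1) := by
  have hder : ∀ x : ℝ, HasDerivAt (fun p : ℝ => tailProb p k)
      (((k : ℝ) + 2) * (k + 1) * x ^ k * (1 - x)) x := by
    intro x
    have h := ((hasDerivAt_pow (k + 1) x).const_mul ((k : ℝ) + 2)).sub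
      ((hasDerivAt_pow (k + 2) x).const_mul ((k : ℝ) + 1))
    refine h.congr_deriv ?_
    push_cast
    ring
  refine monotoneOn_of_deriv_nonneg (convex_Icc 0 1)
    (fun x _ => (hder x).continuousAt.continuousWithinAt)
    (fun x _ => (hder x).differentiableAt.differentiableWithinAt) fun x hx => ?_
  rw [interior_Icc] at hx
  rw [(hder x).deriv]
  have h0 := hx.1
  have h1 : 0 < 1 - x := by linarith [hx.2]
  positivity

lemma monotoneOn_drift (k : ℕ) :
    MonotoneOn (fun p : ℝ => drift p k) (Set.Icc 0 (2 / 3)) := by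
  have hder : ∀ x : ℝ, HasDerivAt (fun p : ℝ => drift p k)
      (x ^ (k + 1) * (((k : ℝ) + 2) - (k + 3) * x) + ((k : ℝ) + 2) * (1 - x) ^ (k + 1)) x := by
    intro x
    have h1 : HasDerivAt (fun p : ℝ => 1 - p) (-1) x := by
      simpa using (hasDerivAt_id x).const_sub 1
    have h := ((hasDerivAt_pow (k + 2) x).mul h1).sub (h1.pow (k + 2))
    refine h.congr_deriv ?_
    push_cast
    ring
  refine monotoneOn_of_deriv_nonneg (convex_Icc _ _)
    (fun x _ => (hder x).continuousAt.continuousWithinAt)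
    (fun x _ => (hder x).differentiableAt.differentiableWithinAt) fun x hx => ?_
  rw [interior_Icc] at hx
  rw [(hder x).deriv]
  have h0 := hx.1
  have h1 : 0 < 1 - x := by linarith [hx.2]
  have h2 : 0 ≤ ((k : ℝ) + 2) - (k + 3) * x := by
    nlinarith [hx.2, (Nat.cast_nonneg k : (0 : ℝ) ≤ k)]
  positivity

lemma tailProb_nonneg {p : ℝ} (h0 : 0 ≤ p) (h1 : p ≤ 1) (k : ℕ) : 0 ≤ tailProb p k := by
  have h := monotoneOn_tailProb k (Set.left_mem_Icc.2 zero_le_one) ⟨h0, h1⟩ h0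
  simpa [tailProb] using h

lemma antitone_tailProb {p : ℝ} (h0 : 0 ≤ p) : Antitone (tailProb p) := by
  refine antitone_nat_of_succ_le fun k => ?_
  have h : tailProb p k - tailProb p (k + 1) = ((k : ℝ) + 2) * p ^ (k + 1) * (1 - p) ^ 2 := by
    simp only [tailProb]
    push_cast
    ring
  have : 0 ≤ ((k : ℝ) + 2) * p ^ (k + 1) * (1 - p) ^ 2 := by positivity
  linarith

lemma tailProb_lt_one {p : ℝ} (h0 : 0 ≤ p) (h1 : p < 1) (k : ℕ) : tailProb p k < 1 := by
  refine (antitone_tailProb h0 k.zero_le).trans_lt ?_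
  simp only [tailProb]
  norm_num
  nlinarith [mul_pos (sub_pos.2 h1) (sub_pos.2 h1)]

lemma tailProb_le_mul_pow {p : ℝ} (h0 : 0 ≤ p) (k : ℕ) :
    tailProb p k ≤ ((k : ℝ) + 2) * p ^ (k + 1) := by
  have : 0 ≤ ((k : ℝ) + 1) * p ^ (k + 2) := by positivity
  simp only [tailProb]
  linarith

lemma summable_mul_pow {p : ℝ} (h0 : 0 ≤ p) (h1 : p < 1) :
    Summable fun k : ℕ => ((k : ℝ) + 2) * p ^ (k + 1) := by
  have hn : ‖p‖ < 1 := by rwa [Real.norm_of_nonneg h0]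
  have h2 := (summable_pow_mul_geometric_of_norm_lt_one 1 hn).mul_right p
  have h3 := (summable_geometric_of_lt_one h0 h1).mul_right (2 * p)
  refine (h2.add h3).congr fun k => ?_
  ring

lemma summable_tailProb {p : ℝ} (h0 : 0 ≤ p) (h1 : p < 1) : Summable (tailProb p) :=
  (summable_mul_pow h0 h1).of_nonneg_of_le (tailProb_nonneg h0 h1.le) (tailProb_le_mul_pow h0)

lemma pow_le_pow_of_base {p : ℝ} (h0 : 1 / 2 ≤ p) (h1 : p ≤ 1) {m : ℕ}
    (hm : (1 - p) ^ m ≤ p ^ (m + 1)) {n : ℕ} (hmn : m ≤ n) : (1 - p) ^ n ≤ p ^ (n + 1) := by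
  induction n, hmn using Nat.le_induction with
  | base => exact hm
  | succ n _ ih =>
    calc (1 - p) ^ (n + 1) = (1 - p) ^ n * (1 - p) := pow_succ _ _
      _ ≤ p ^ (n + 1) * p := by
        gcongr
        linarith
      _ = p ^ (n + 1 + 1) := (pow_succ _ _).symm

lemma drift_nonneg_of_pow_le {p : ℝ} (h1 : p ≤ 1) {k : ℕ}
    (h : (1 - p) ^ (k + 1) ≤ p ^ (k + 2)) : 0 ≤ drift p k := by
  have : drift p k = (p ^ (k + 2) - (1 - p) ^ (k + 1)) * (1 - p) := by
    simp only [drift]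
    ring
  rw [this]
  exact mul_nonneg (by linarith) (by linarith)

lemma drift_nonneg {p : ℝ} (h0 : 27 / 50 ≤ p) (h1 : p ≤ 1) {k : ℕ} (hk : 3 ≤ k) :
    0 ≤ drift p k := by
  refine drift_nonneg_of_pow_le h1 (pow_le_pow_of_base (by linarith) h1 (m := 4) ?_ (by omega))
  have h2 : (1 - p) ^ 4 ≤ (23 / 50 : ℝ) ^ 4 := pow_le_pow_left₀ (by linarith) (by linarith) 4
  have h3 : (27 / 50 : ℝ) ^ 5 ≤ p ^ 5 := pow_le_pow_left₀ (by norm_num) h0 5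
  norm_num at h2 h3 ⊢
  linarith

lemma abs_drift_le {p : ℝ} (h0 : 1 / 2 ≤ p) (h1 : p ≤ 1) (k : ℕ) :
    |drift p k| ≤ tailProb p k := by
  have hp : 0 ≤ p := by linarith
  have hq : 0 ≤ 1 - p := by linarith
  have ht : tailProb p k = p ^ (k + 2) + ((k : ℝ) + 2) * p ^ (k + 1) * (1 - p) := by
    simp only [tailProb]
    ring
  have h2 : (1 - p) ^ (k + 2) ≤ p ^ (k + 2) := pow_le_pow_left₀ hq (by linarith) _
  have h3 : 0 ≤ ((k : ℝ) + 2) * p ^ (k + 1) * (1 - p) := by positivity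
  have h4 : 0 ≤ p ^ (k + 2) * (1 - p) := by positivity
  have h5 : 0 ≤ p ^ (k + 2) * p := by positivity
  have h6 : 0 ≤ (1 - p) ^ (k + 2) := by positivity
  rw [abs_le, ht, drift]
  constructor <;> nlinarith

/-! ### The linearised recursion -/

/-- The drift, truncated below at zero for at least five coins. -/
noncomputable def posDrift (p : ℝ) (k : ℕ) : ℝ :=
  if k < 3 then drift p k else max (drift p k) 0

/-- The solution of the linearised recursion; `envelope p k` is compared with `s p (k + 1)`. -/
noncomputable def envelope (p : ℝ) : ℕ → ℝ
  | 0 => 0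
  | k + 1 => (1 - tailProb p k) * envelope p k + posDrift p k

lemma drift_le_posDrift (p : ℝ) (k : ℕ) : drift p k ≤ posDrift p k := by
  unfold posDrift
  split_ifs <;> simp

lemma posDrift_eq_drift {p : ℝ} (h0 : 27 / 50 ≤ p) (h1 : p ≤ 1) (k : ℕ) :
    posDrift p k = drift p k := by
  unfold posDrift
  split_ifs with hk
  · rfl
  · exact max_eq_left (drift_nonneg h0 h1 (by omega))

lemma posDrift_nonneg (p : ℝ) {k : ℕ} (hk : 3 ≤ k) : 0 ≤ posDrift p k := by
  simp [posDrift, hk.not_gt]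

lemma monotoneOn_posDrift (k : ℕ) :
    MonotoneOn (fun p : ℝ => posDrift p k) (Set.Icc 0 (2 / 3)) := by
  intro p hp q hq hpq
  have := monotoneOn_drift k hp hq hpq
  simp only [posDrift] at this ⊢
  split_ifs
  · exact this
  · exact max_le_max_right 0 this

/-- A positive sequence with summable relative losses stays bounded away from zero. -/
lemma eventually_ge_of_mul_le_succ {c x : ℕ → ℝ} (hc0 : ∀ k, 0 ≤ c k) (hc1 : ∀ k, c k < 1)
    (hc : Summable c) {m : ℕ} (hm : 0 < x m) (h : ∀ k ≥ m, (1 - c k) * x k ≤ x (k + 1)) :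
    ∃ ε > 0, ∀ᶠ k in atTop, ε ≤ x k := by
  have hpos : ∀ k ≥ m, 0 < x k := by
    intro k hk
    induction k, hk using Nat.le_induction with
    | base => exact hm
    | succ k hk ih => exact (mul_pos (sub_pos.2 (hc1 k)) ih).trans_le (h k hk)
  obtain ⟨M, hM, hmM⟩ := (((tendsto_sum_nat_add c).eventually
    (gt_mem_nhds (by norm_num : (0 : ℝ) < 1 / 2))).and (eventually_ge_atTop m)).exists
  have hS : ∀ n, ∑ i ∈ range n, c (i + M) ≤ 1 / 2 := fun n =>
    (((summable_nat_add_iff M).2 hc).sum_le_tsum _ fun i _ => hc0 _).trans hM.le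
  have hx : ∀ n, x M * (1 - ∑ i ∈ range n, c (i + M)) ≤ x (n + M) := by
    intro n
    induction n with
    | zero => simp
    | succ n ih =>
      have h1 := h (n + M) (by omega)
      rw [show n + 1 + M = n + M + 1 by ring, sum_range_succ]
      have h2 := mul_le_mul_of_nonneg_left ih (sub_nonneg.2 (hc1 (n + M)).le)
      have h3 : 0 ≤ ∑ i ∈ range n, c (i + M) := sum_nonneg fun i _ => hc0 _
      have h4 := mul_nonneg (hpos M hmM).le (mul_nonneg (hc0 (n + M)) h3)
      nlinarith
  refine ⟨x M / 2, half_pos (hpos M hmM), (eventually_ge_atTop M).mono fun k hk => ?_⟩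
  obtain ⟨n, rfl⟩ := Nat.exists_eq_add_of_le' hk
  have := hx n
  nlinarith [hS n, hpos M hmM]

lemma abs_envelope_le_one {p : ℝ} (h0 : 27 / 50 ≤ p) (h1 : p < 1) (k : ℕ) :
    |envelope p k| ≤ 1 := by
  induction k with
  | zero => simp [envelope]
  | succ k ih =>
    have hd := abs_drift_le (by linarith) h1.le (p := p) k
    have ht := tailProb_lt_one (by linarith) h1 k
    rw [envelope, posDrift_eq_drift h0 h1.le]
    calc _ ≤ |(1 - tailProb p k) * envelope p k| + |drift p k| := abs_add_le _ _
      _ ≤ (1 - tailProb p k) * 1 + tailProb p k := by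
        rw [abs_mul, abs_of_pos (sub_pos.2 ht)]
        gcongr
      _ = 1 := by ring

lemma abs_envelope_succ_sub_le {p : ℝ} (h0 : 27 / 50 ≤ p) (h1 : p < 1) (k : ℕ) :
    |envelope p (k + 1) - envelope p k| ≤ 2 * (((k : ℝ) + 2) * p ^ (k + 1)) := by
  have hd := abs_drift_le (by linarith) h1.le (p := p) k
  have ht := tailProb_nonneg (by linarith) h1.le (p := p) k
  have hle := tailProb_le_mul_pow (by linarith : 0 ≤ p) k
  have : envelope p (k + 1) - envelope p k = drift p k - tailProb p k * envelope p k := by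
    rw [envelope, posDrift_eq_drift h0 h1.le]
    ring
  rw [this]
  calc _ ≤ |drift p k| + |tailProb p k * envelope p k| := abs_sub _ _
    _ ≤ tailProb p k + tailProb p k * 1 := by
      rw [abs_mul, abs_of_nonneg ht]
      gcongr
      exact abs_envelope_le_one h0 h1 k
    _ ≤ _ := by linarith

lemma continuousOn_envelope (k : ℕ) :
    ContinuousOn (fun p => envelope p k) (Set.Icc (27 / 50) (11 / 20)) := by
  induction k with
  | zero => exact continuousOn_const
  | succ k ih =>
    have h : ContinuousOn (fun p : ℝ => (1 - tailProb p k) * envelope p k + drift p k)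
        (Set.Icc (27 / 50) (11 / 20)) := by
      refine (ContinuousOn.mul ?_ ih).add ?_
      · unfold tailProb
        fun_prop
      · unfold drift
        fun_prop
    refine h.congr fun p hp => ?_
    simp only [envelope]
    rw [posDrift_eq_drift hp.1 (by linarith [hp.2])]

/-- The limit of the linearised recursion exists and depends continuously on `p`. -/
lemma exists_continuousOn_tendsto_envelope :
    ∃ W : ℝ → ℝ, ContinuousOn W (Set.Icc (27 / 50) (11 / 20)) ∧
      ∀ p ∈ Set.Icc (27 / 50 : ℝ) (11 / 20), Tendsto (envelope p) atTop (𝓝 (W p)) := by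
  have hsum : Summable fun k : ℕ => 2 * (((k : ℝ) + 2) * (11 / 20 : ℝ) ^ (k + 1)) :=
    (summable_mul_pow (by norm_num) (by norm_num)).mul_left 2
  have hbound : ∀ (k : ℕ), ∀ p ∈ Set.Icc (27 / 50 : ℝ) (11 / 20),
      ‖envelope p (k + 1) - envelope p k‖ ≤ 2 * (((k : ℝ) + 2) * (11 / 20 : ℝ) ^ (k + 1)) := by
    intro k p hp
    have hp0 : 0 ≤ p := by linarith [hp.1]
    refine (abs_envelope_succ_sub_le hp.1 (by linarith [hp.2]) k).trans ?_
    have := hp.2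
    gcongr
  refine ⟨fun p => ∑' k, (envelope p (k + 1) - envelope p k),
    continuousOn_tsum (fun k => (continuousOn_envelope (k + 1)).sub (continuousOn_envelope k))
      hsum hbound, fun p hp => ?_⟩
  have := (hsum.of_norm_bounded fun k => hbound k p hp).hasSum.tendsto_sum_nat
  simpa only [sum_range_sub, show envelope p 0 = 0 from rfl, sub_zero] using this

/-! ### Comparison of `s` with the linearised recursion -/

lemma sum_Icc_choose (p : ℝ) (n : ℕ) :
    ∑ j ∈ Icc 1 n, ((n + 2).choose j : ℝ) * p ^ j * (1 - p) ^ (n + 2 - j) =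
      1 - tailProb p n - (1 - p) ^ (n + 2) := by
  have h : ∑ j ∈ range (n + 3), ((n + 2).choose j : ℝ) * p ^ j * (1 - p) ^ (n + 2 - j) = 1 := by
    have h1 := add_pow p (1 - p) (n + 2)
    rw [add_sub_cancel, one_pow] at h1
    rw [eq_comm]
    refine h1.trans (sum_congr rfl fun j _ => ?_)
    ring
  rw [sum_range_succ, sum_range_succ, sum_range_succ'] at h
  have hI : ∑ j ∈ Icc 1 n, ((n + 2).choose j : ℝ) * p ^ j * (1 - p) ^ (n + 2 - j) =
      ∑ j ∈ range n, ((n + 2).choose (j + 1) : ℝ) * p ^ (j + 1) * (1 - p) ^ (n + 2 - (j + 1)) := by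
    rw [← Finset.Ico_succ_right_eq_Icc, Finset.sum_Ico_eq_sum_range]
    simp [add_comm]
  have hc : (n + 2).choose (n + 1) = n + 2 := Nat.choose_succ_self_right (n + 1)
  have hsub : ∀ j, n + 2 - (j + 1) = n + 1 - j := fun j => by omega
  rw [hI]
  simp only [hsub, hc, Nat.choose_self, Nat.choose_zero_right, Nat.add_sub_cancel_left,
    Nat.sub_self, Nat.sub_zero] at h ⊢
  simp only [tailProb]
  push_cast at h
  linear_combination h

lemma sum_Icc_choose_mul (p A x : ℝ) (n : ℕ) :
    ∑ j ∈ Icc 1 (n + 1), ((n + 2).choose j : ℝ) * p ^ j * (1 - p) ^ (n + 2 - j) *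
        (A + if j = n + 1 then 0 else x) =
      A * (1 - p ^ (n + 2) - (1 - p) ^ (n + 2)) +
        (1 - tailProb p n - (1 - p) ^ (n + 2)) * x := by
  have hc : (n + 2).choose (n + 1) = n + 2 := Nat.choose_succ_self_right (n + 1)
  rw [Finset.sum_Icc_succ_top (by omega)]
  have hI : ∑ j ∈ Icc 1 n, ((n + 2).choose j : ℝ) * p ^ j * (1 - p) ^ (n + 2 - j) *
        (A + if j = n + 1 then 0 else x) =
      (∑ j ∈ Icc 1 n, ((n + 2).choose j : ℝ) * p ^ j * (1 - p) ^ (n + 2 - j)) * (A + x) := by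
    rw [sum_mul]
    refine sum_congr rfl fun j hj => ?_
    rw [if_neg (by have := (mem_Icc.1 hj).2; omega)]
  rw [hI, sum_Icc_choose, hc, if_pos rfl, show n + 2 - (n + 1) = 1 by omega]
  simp only [tailProb]
  push_cast
  ring

lemma v_le {p : ℝ} (h0 : 0 ≤ p) (h1 : p ≤ 1) (n : ℕ) (g : ℕ → ℝ)
    (hg : ∀ j ∈ Icc 1 (n + 1), ∀ i ∈ Icc 1 j, v p (n + 2 - i) + i ≤ g j) :
    v p (n + 2) ≤ ((n : ℝ) + 2) * p ^ (n + 2) + v p (n + 1) * (1 - p) ^ (n + 2) +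
      ∑ j ∈ Icc 1 (n + 1), ((n + 2).choose j : ℝ) * p ^ j * (1 - p) ^ (n + 2 - j) * g j := by
  have hq : 0 ≤ 1 - p := by linarith
  rw [v, ← Finset.sum_attach (Icc 1 (n + 1))]
  refine add_le_add (le_of_eq ?_) (sum_le_sum fun j _ => ?_)
  · push_cast
    ring
  · refine mul_le_mul_of_nonneg_left (Finset.sup'_le _ _ fun i _ => ?_) (by positivity)
    exact hg j.1 j.2 i.1 i.2

lemma le_v {p : ℝ} (h0 : 0 ≤ p) (h1 : p ≤ 1) (n : ℕ) (g : ℕ → ℝ)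
    (hg : ∀ j ∈ Icc 1 (n + 1), ∃ i ∈ Icc 1 j, g j ≤ v p (n + 2 - i) + i) :
    ((n : ℝ) + 2) * p ^ (n + 2) + v p (n + 1) * (1 - p) ^ (n + 2) +
      ∑ j ∈ Icc 1 (n + 1), ((n + 2).choose j : ℝ) * p ^ j * (1 - p) ^ (n + 2 - j) * g j ≤
      v p (n + 2) := by
  have hq : 0 ≤ 1 - p := by linarith
  rw [show n + 2 = n + 1 + 1 from rfl, v.eq_2 p (n + 1), ← Finset.sum_attach (Icc 1 (n + 1))]
  refine add_le_add (le_of_eq ?_) (sum_le_sum fun j _ => ?_)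
  · push_cast
    ring
  · obtain ⟨i, hi, hgi⟩ := hg j.1 j.2
    refine mul_le_mul_of_nonneg_left (hgi.trans ?_) (by positivity)
    exact Finset.le_sup' (fun i : {x : ℕ // x ∈ Icc 1 j.1} => v p (n + 1 + 1 - i.1) + (i.1 : ℝ))
      (mem_attach _ ⟨i, hi⟩)

lemma v_sub_add (p : ℝ) {n i : ℕ} (hi : i ≤ n + 2) :
    v p (n + 2 - i) + i = (n + 1 + p) + s p (n + 2 - i) := by
  simp only [s, Nat.cast_sub hi]
  push_cast
  ring

lemma s_one (p : ℝ) : s p 1 = 0 := by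
  have h : v p 1 = p := by
    rw [v, sum_eq_zero fun j _ => absurd (mem_Icc.1 j.2) (by omega)]
    simp [v]
  simp [s, h]

lemma s_succ_succ_le {p x : ℝ} (h0 : 0 ≤ p) (h1 : p ≤ 1) (n : ℕ)
    (hx1 : s p (n + 1) ≤ x) (hx : ∀ j, 2 ≤ j → j ≤ n + 1 → s p j ≤ x)
    (hneg : ∀ j, 1 ≤ j → j ≤ n + 1 → s p j ≤ 0) :
    s p (n + 2) ≤ (1 - tailProb p n) * x + drift p n := by
  have hv := v_le h0 h1 n (fun j => ((n : ℝ) + 1 + p) + if j = n + 1 then 0 else x) ?_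
  · rw [sum_Icc_choose_mul] at hv
    have hvs : v p (n + 1) = s p (n + 1) + n + p := by
      simp only [s]
      push_cast
      ring
    have hs := mul_le_mul_of_nonneg_left hx1 (pow_nonneg (sub_nonneg.2 h1) (n + 2))
    rw [hvs] at hv
    rw [s, drift]
    push_cast
    linarith
  · intro j hj i hi
    rw [mem_Icc] at hi hj
    rw [v_sub_add p (by omega)]
    split_ifs with h
    · linarith [hneg (n + 2 - i) (by omega) (by omega)]
    · linarith [hx (n + 2 - i) (by omega) (by omega)]

lemma le_s_succ_succ {p : ℝ} (h0 : 0 ≤ p) (h1 : p ≤ 1) (n : ℕ) :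
    (1 - tailProb p n) * s p (n + 1) + drift p n ≤ s p (n + 2) := by
  have hv := le_v h0 h1 n
    (fun j => ((n : ℝ) + 1 + p) + if j = n + 1 then 0 else s p (n + 1)) ?_
  · rw [sum_Icc_choose_mul] at hv
    have hvs : v p (n + 1) = s p (n + 1) + n + p := by
      simp only [s]
      push_cast
      ring
    rw [hvs] at hv
    rw [s.eq_1 p (n + 2), drift]
    push_cast
    linarith
  · intro j hj
    rw [mem_Icc] at hj
    split_ifs with h
    · refine ⟨j, mem_Icc.2 ⟨hj.1, le_rfl⟩, ?_⟩
      rw [v_sub_add p (by omega), h, show n + 2 - (n + 1) = 1 by omega, s_one]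
    · refine ⟨1, mem_Icc.2 ⟨le_rfl, hj.1⟩, ?_⟩
      rw [v_sub_add p (by omega), show n + 2 - 1 = n + 1 by omega]

lemma envelope_le_s {p : ℝ} (h0 : 27 / 50 ≤ p) (h1 : p < 1) (k : ℕ) :
    envelope p k ≤ s p (k + 1) := by
  induction k with
  | zero => simp [envelope, s_one]
  | succ k ih =>
    refine le_trans ?_ (le_s_succ_succ (by linarith) h1.le k)
    rw [envelope, posDrift_eq_drift h0 h1.le]
    have := sub_nonneg.2 (tailProb_lt_one (by linarith) h1 k).le
    gcongr

lemma envelope_one (p : ℝ) : envelope p 1 = (1 - p) * (p ^ 2 - (1 - p)) := by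
  simp [envelope, posDrift, drift]
  ring

lemma envelope_two (p : ℝ) :
    envelope p 2 = (1 - tailProb p 1) * envelope p 1 + drift p 1 := by
  simp [envelope, posDrift]

lemma envelope_three (p : ℝ) :
    envelope p 3 = (1 - tailProb p 2) * envelope p 2 + drift p 2 := by
  simp [envelope, posDrift]

lemma envelope_le_succ {p : ℝ} (h0 : 1 / 2 ≤ p) (h1 : p ≤ 11 / 20) {k : ℕ} (hk : 1 ≤ k)
    (hneg : envelope p k ≤ 0) : envelope p k ≤ envelope p (k + 1) := by
  obtain rfl | rfl | hk : k = 1 ∨ k = 2 ∨ 3 ≤ k := by omega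
  · rw [envelope_two, envelope_one, tailProb, drift]
    have hfac : 0 ≤ (1 - p) * ((2 * p - 1) * (1 - p ^ 2) ^ 2) :=
      mul_nonneg (by linarith) (mul_nonneg (by linarith) (sq_nonneg _))
    norm_num
    linarith
  · rw [envelope_three, envelope_two, envelope_one, tailProb, tailProb, drift, drift]
    obtain ⟨e, rfl⟩ : ∃ e, p = 1 / 2 + e := ⟨p - 1 / 2, by ring⟩
    have he0 : 0 ≤ e := by linarith
    have he1 : e ≤ 1 / 20 := by linarith
    have he5 : e ^ 5 ≤ (1 / 20) ^ 5 := pow_le_pow_left₀ he0 he1 5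
    have hmain : 0 ≤ e * (83 / 128 - 59 / 16 * e - 17 * e ^ 5) :=
      mul_nonneg he0 (by norm_num at he5; linarith)
    have hrest : 0 ≤ 1 / 64 + 9 / 8 * e ^ 3 + 39 / 4 * e ^ 4 + 1 / 4 * e ^ 5 + 2 * e ^ 7 +
        16 * e ^ 8 + 6 * e ^ 9 := by positivity
    have hfac := mul_nonneg (by linarith : 0 ≤ 1 / 2 - e) (add_nonneg hmain hrest)
    norm_num
    linarith
  · rw [envelope]
    have := mul_nonpos_of_nonneg_of_nonpos
      (tailProb_nonneg (by linarith : 0 ≤ p) (by linarith) k) hneg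
    linarith [posDrift_nonneg p hk]

lemma envelope_le_of_le {p : ℝ} (h0 : 1 / 2 ≤ p) (h1 : p ≤ 11 / 20)
    (hneg : ∀ k, envelope p k ≤ 0) {j k : ℕ} (hj : 1 ≤ j) (hjk : j ≤ k) :
    envelope p j ≤ envelope p k := by
  induction k, hjk using Nat.le_induction with
  | base => exact le_rfl
  | succ k hk ih => exact ih.trans (envelope_le_succ h0 h1 (hj.trans hk) (hneg k))

lemma s_le_envelope {p : ℝ} (h0 : 1 / 2 ≤ p) (h1 : p ≤ 11 / 20)
    (hneg : ∀ k, envelope p k ≤ 0) (k : ℕ) : s p (k + 1) ≤ envelope p k := by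
  induction k using Nat.strong_induction_on with
  | _ k ih =>
    cases k with
    | zero => simp [envelope, s_one]
    | succ k =>
      refine (s_succ_succ_le (by linarith) (by linarith) k (ih k k.lt_succ_self) ?_ ?_).trans
        (add_le_add_right (drift_le_posDrift p k) _)
      · intro j hj2 hjk
        obtain ⟨j, rfl⟩ := Nat.exists_eq_add_of_le' (by omega : 1 ≤ j)
        exact (ih j (by omega)).trans
          (envelope_le_of_le h0 h1 hneg (by omega) (by omega))
      · intro j hj1 hjk
        obtain ⟨j, rfl⟩ := Nat.exists_eq_add_of_le' hj1
        exact (ih j (by omega)).trans (hneg j)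

/-- The linearised recursion is strictly monotone in `p`, eventually uniformly in the index. -/
lemma envelope_le_and_exists_add_le {p q : ℝ} (h0 : 1 / 2 ≤ p) (hpq : p < q) (h1 : q ≤ 31 / 50)
    (hneg : (∀ k, envelope p k ≤ 0) ∨ ∀ k, envelope q k ≤ 0) :
    (∀ k, envelope p k ≤ envelope q k) ∧
      ∃ ε > 0, ∀ᶠ k in atTop, envelope p k + ε ≤ envelope q k := by
  have hc : ∀ k, tailProb p k ≤ tailProb q k := fun k =>
    monotoneOn_tailProb k ⟨by linarith, by linarith⟩ ⟨by linarith, by linarith⟩ hpq.le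
  have hd : ∀ k, posDrift p k ≤ posDrift q k := fun k =>
    monotoneOn_posDrift k ⟨by linarith, by linarith⟩ ⟨by linarith, by linarith⟩ hpq.le
  have key : ∃ r : ℝ, 0 ≤ r ∧ r < 1 ∧ ∀ k, (1 - tailProb r k) *
      (envelope q k - envelope p k) ≤ envelope q (k + 1) - envelope p (k + 1) := by
    rcases hneg with hneg | hneg
    · refine ⟨q, by linarith, by linarith, fun k => ?_⟩
      have := mul_nonneg_of_nonpos_of_nonpos (hneg k) (sub_nonpos.2 (hc k))
      simp only [envelope]
      linarith [hd k]
    · refine ⟨p, by linarith, by linarith, fun k => ?_⟩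
      have := mul_nonneg_of_nonpos_of_nonpos (hneg k) (sub_nonpos.2 (hc k))
      simp only [envelope]
      linarith [hd k]
  obtain ⟨r, hr0, hr1, hr⟩ := key
  have hone : 0 < envelope q 1 - envelope p 1 := by
    have hfac : envelope q 1 - envelope p 1 =
        (q - p) * (2 - (p ^ 2 + p * q + q ^ 2)) := by
      simp only [envelope_one]
      ring
    rw [hfac]
    exact mul_pos (by linarith) (by nlinarith)
  obtain ⟨ε, hε, h⟩ := eventually_ge_of_mul_le_succ (x := fun k => envelope q k - envelope p k)
    (tailProb_nonneg hr0 hr1.le) (tailProb_lt_one hr0 hr1) (summable_tailProb hr0 hr1) hone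
    fun k _ => hr k
  refine ⟨fun k => ?_, ε, hε, h.mono fun k hk => by linarith⟩
  induction k with
  | zero => exact le_rfl
  | succ k ih =>
    have := mul_nonneg (sub_nonneg.2 (tailProb_lt_one hr0 hr1 k).le) (sub_nonneg.2 ih)
    linarith [hr k]

/-- Once the linearised recursion is positive it stays bounded away from zero. -/
lemma exists_le_envelope {p : ℝ} (h0 : 27 / 50 ≤ p) (h1 : p < 1) {m : ℕ}
    (hm : 0 < envelope p m) (hd : ∀ k ≥ m, 0 ≤ posDrift p k) :
    ∃ ε > 0, ∀ᶠ k in atTop, ε ≤ envelope p k := by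
  have hp : 0 ≤ p := by linarith
  refine eventually_ge_of_mul_le_succ (tailProb_nonneg hp h1.le)
    (tailProb_lt_one hp h1) (summable_tailProb hp h1) hm fun k hk => ?_
  rw [envelope]
  linarith [hd k hk]

lemma envelope_nonpos {p : ℝ} (h0 : 27 / 50 ≤ p) (h1 : p ≤ 5496 / 10000)
    (hlim : Tendsto (envelope p) atTop (𝓝 0)) (k : ℕ) : envelope p k ≤ 0 := by
  have hp : 0 ≤ p := by linarith
  have hq : 0 ≤ 1 - p := by linarith
  have h2 : p ^ 2 ≤ 1 - p := by nlinarith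
  have h3 : p ^ 3 ≤ (1 - p) ^ 2 := by nlinarith
  have h4 : p ^ 4 ≤ (1 - p) ^ 3 := by
    have h5 : p ^ 4 ≤ (5496 / 10000 : ℝ) ^ 4 := pow_le_pow_left₀ hp h1 4
    have h6 : (4504 / 10000 : ℝ) ^ 3 ≤ (1 - p) ^ 3 :=
      pow_le_pow_left₀ (by norm_num) (by linarith) 3
    norm_num at h5 h6 ⊢
    linarith
  have e1 : envelope p 1 ≤ 0 := by
    rw [envelope_one]
    exact mul_nonpos_of_nonneg_of_nonpos hq (by linarith)
  have e2 : envelope p 2 ≤ 0 := by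
    have := mul_nonpos_of_nonneg_of_nonpos
      (sub_nonneg.2 (tailProb_lt_one hp (by linarith) 1).le) e1
    have hd : drift p 1 = (p ^ 3 - (1 - p) ^ 2) * (1 - p) := by
      simp only [drift]
      ring
    rw [envelope_two, hd]
    nlinarith
  have e3 : envelope p 3 ≤ 0 := by
    have := mul_nonpos_of_nonneg_of_nonpos
      (sub_nonneg.2 (tailProb_lt_one hp (by linarith) 2).le) e2
    have hd : drift p 2 = (p ^ 4 - (1 - p) ^ 3) * (1 - p) := by
      simp only [drift]
      ring
    rw [envelope_three, hd]
    nlinarith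
  obtain rfl | rfl | rfl | hk : k = 0 ∨ k = 1 ∨ k = 2 ∨ 3 ≤ k := by omega
  · exact le_rfl
  · exact e1
  · exact e2
  · by_contra! hpos
    obtain ⟨ε, hε, h⟩ := exists_le_envelope h0 (by linarith) hpos
      fun j hj => posDrift_nonneg p (hk.trans hj)
    linarith [ge_of_tendsto hlim h]

/-! ### Numerical location of the root -/

/-- Rational version of the linearised recursion, for evaluation in the kernel. -/
def rationalEnvelope (p : ℚ) : ℕ → ℚ
  | 0 => 0
  | k + 1 => (1 - tailProb p k) * rationalEnvelope p k + drift p k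

lemma envelope_ratCast {p : ℚ} (h0 : 27 / 50 ≤ (p : ℝ)) (h1 : (p : ℝ) ≤ 1) (k : ℕ) :
    envelope p k = rationalEnvelope p k := by
  induction k with
  | zero => simp [envelope, rationalEnvelope]
  | succ k ih =>
    rw [envelope, rationalEnvelope, ih, posDrift_eq_drift h0 h1]
    simp only [tailProb, drift]
    push_cast
    rfl

lemma rationalEnvelope_lower :
    rationalEnvelope (5495021777642 / 10 ^ 13) 59 ≤ -2 * (5495021777642 / 10 ^ 13) ^ 61 := by
  decide +kernel

lemma rationalEnvelope_upper :
    0 ≤ rationalEnvelope (54950217776421 / 10 ^ 14) 59 := by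
  decide +kernel

lemma envelope_le_neg_pow {p : ℝ} (h0 : 27 / 50 ≤ p) (h1 : p ≤ 3 / 5) {m : ℕ}
    (hc : tailProb p m ≤ 1 / 5) (hm : envelope p m ≤ -2 * p ^ (m + 2)) {k : ℕ} (hk : m ≤ k) :
    envelope p k ≤ -2 * p ^ (k + 2) := by
  induction k, hk using Nat.le_induction with
  | base => exact hm
  | succ k hk ih =>
    have hp : 0 ≤ p := by linarith
    have hck := (antitone_tailProb hp hk).trans hc
    have hpow : 0 ≤ p ^ (k + 2) := by positivity
    have hq : 0 ≤ (1 - p) ^ (k + 2) := pow_nonneg (by linarith) _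
    have h2 := mul_le_mul_of_nonneg_left ih (by linarith : 0 ≤ 1 - tailProb p k)
    have h3 := mul_le_mul_of_nonneg_right hck hpow
    have h4 := mul_le_mul_of_nonneg_right h1 hpow
    rw [envelope, posDrift_eq_drift h0 (by linarith), drift, show k + 1 + 2 = k + 2 + 1 from rfl,
      pow_succ p (k + 2)]
    linarith

lemma envelope_lower_nonpos {k : ℕ} (hk : 59 ≤ k) : envelope 0.5495021777642 k ≤ 0 := by
  have hcast := envelope_ratCast (p := 5495021777642 / 10 ^ 13) (by norm_num) (by norm_num) 59
  have hle : ((rationalEnvelope (5495021777642 / 10 ^ 13) 59 : ℚ) : ℝ) ≤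
      ((-2 * (5495021777642 / 10 ^ 13) ^ 61 : ℚ) : ℝ) := by
    exact_mod_cast rationalEnvelope_lower
  rw [← hcast] at hle
  push_cast at hle
  rw [show (5495021777642 / 10 ^ 13 : ℝ) = 0.5495021777642 by norm_num] at hle
  refine (envelope_le_neg_pow (by norm_num) (by norm_num) ?_ hle hk).trans ?_
  · norm_num [tailProb]
  · exact mul_nonpos_of_nonpos_of_nonneg (by norm_num) (pow_nonneg (by norm_num) _)

lemma envelope_upper_nonneg {k : ℕ} (hk : 59 ≤ k) : 0 ≤ envelope 0.54950217776421 k := by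
  induction k, hk using Nat.le_induction with
  | base =>
    have hcast := envelope_ratCast (p := 54950217776421 / 10 ^ 14) (by norm_num) (by norm_num) 59
    have hle : (0 : ℝ) ≤ (rationalEnvelope (54950217776421 / 10 ^ 14) 59 : ℚ) := by
      exact_mod_cast rationalEnvelope_upper
    rw [← hcast] at hle
    convert hle using 2
    norm_num
  | succ k hk ih =>
    rw [envelope]
    exact add_nonneg (mul_nonneg
      (sub_nonneg.2 (tailProb_lt_one (by norm_num) (by norm_num) k).le) ih)
      (posDrift_nonneg _ (by omega))

lemma exists_tendsto_envelope_zero :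
    ∃ p ∈ Set.Icc (0.5495021777642 : ℝ) 0.54950217776421,
      Tendsto (envelope p) atTop (𝓝 0) := by
  obtain ⟨W, hW, hlim⟩ := exists_continuousOn_tendsto_envelope
  have hsub : Set.Icc (0.5495021777642 : ℝ) 0.54950217776421 ⊆ Set.Icc (27 / 50) (11 / 20) :=
    Set.Icc_subset_Icc (by norm_num) (by norm_num)
  have hlow : W 0.5495021777642 ≤ 0 :=
    le_of_tendsto (hlim _ (hsub (Set.left_mem_Icc.2 (by norm_num))))
      ((eventually_ge_atTop 59).mono fun _ => envelope_lower_nonpos)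
  have hupp : 0 ≤ W 0.54950217776421 :=
    ge_of_tendsto (hlim _ (hsub (Set.right_mem_Icc.2 (by norm_num))))
      ((eventually_ge_atTop 59).mono fun _ => envelope_upper_nonneg)
  obtain ⟨p, hp, hp0⟩ := intermediate_value_Icc (by norm_num) (hW.mono hsub) ⟨hlow, hupp⟩
  exact ⟨p, hp, hp0 ▸ hlim p (hsub hp)⟩

lemma exists_le_envelope_of_large {p : ℝ} (h0 : 31 / 50 ≤ p) (h1 : p < 1) :
    ∃ ε > 0, ∀ᶠ k in atTop, ε ≤ envelope p k := by
  refine exists_le_envelope (by linarith) h1 (m := 1) ?_ fun k hk => ?_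
  · rw [envelope_one]
    exact mul_pos (by linarith) (by nlinarith)
  · refine (drift_nonneg_of_pow_le h1.le ?_).trans (drift_le_posDrift p k)
    refine pow_le_pow_of_base (by linarith) h1.le (m := 1) ?_ (by omega)
    norm_num
    nlinarith

end CoinGame

open CoinGame Filter Topology

theorem coin_game_unique_root (S : ℝ → ℝ)
    (hS : ∀ p : ℝ, 1 / 2 ≤ p → p ≤ 1 →
      Filter.Tendsto (fun n : ℕ => s p n) Filter.atTop (nhds (S p))) :
    ∃ p0 : ℝ, (1 / 2 ≤ p0 ∧ p0 < 1 ∧ S p0 = 0) ∧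
      (∀ q : ℝ, 1 / 2 ≤ q → q < 1 → S q = 0 → q = p0) ∧
      (∀ p : ℝ, 1 / 2 ≤ p → p < p0 → S p < 0) ∧
      (∀ p : ℝ, p0 < p → p < 1 → 0 < S p) ∧
      0.5495021777642 ≤ p0 ∧ p0 ≤ 0.54950217776421 := by
  obtain ⟨p0, ⟨hl, hu⟩, hlim⟩ := exists_tendsto_envelope_zero
  have hl' : 27 / 50 ≤ p0 := le_trans (by norm_num) hl
  have hu' : p0 ≤ 5496 / 10000 := hu.trans (by norm_num)
  have hS' : ∀ p : ℝ, 1 / 2 ≤ p → p ≤ 1 →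
      Tendsto (fun k : ℕ => s p (k + 1)) atTop (𝓝 (S p)) := fun p h0 h1 =>
    (tendsto_add_atTop_iff_nat 1).2 (hS p h0 h1)
  have hnonpos := envelope_nonpos hl' hu' hlim
  have hzero : S p0 = 0 := by
    refine tendsto_nhds_unique (hS' p0 (by linarith) (by linarith)) (hlim.congr fun k => ?_)
    exact le_antisymm (envelope_le_s hl' (by linarith) k)
      (s_le_envelope (by linarith) (by linarith) hnonpos k)
  have hneg : ∀ p : ℝ, 1 / 2 ≤ p → p < p0 → S p < 0 := by
    intro p hp hpp
    obtain ⟨hle, ε, hε, h⟩ :=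
      envelope_le_and_exists_add_le hp hpp (by linarith) (.inr hnonpos)
    have : S p ≤ -ε := by
      refine le_of_tendsto (hS' p hp (by linarith)) (h.mono fun k hk => ?_)
      have h1 := s_le_envelope hp (by linarith) (fun k => (hle k).trans (hnonpos k)) k
      linarith [hnonpos k]
    linarith
  have hpos : ∀ p : ℝ, p0 < p → p < 1 → 0 < S p := by
    intro p hpp hp1
    have hp : 27 / 50 ≤ p := by linarith
    have hSp := hS' p (by linarith) hp1.le
    obtain h | h := le_total p (31 / 50)
    · obtain ⟨-, ε, hε, h⟩ :=
        envelope_le_and_exists_add_le (by linarith) hpp h (.inl hnonpos)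
      have hlim' := hlim.add_const ε
      rw [zero_add] at hlim'
      exact hε.trans_le (le_of_tendsto_of_tendsto hlim' hSp
        (h.mono fun k hk => hk.trans (envelope_le_s hp hp1 k)))
    · obtain ⟨ε, hε, h⟩ := exists_le_envelope_of_large h hp1
      exact hε.trans_le (ge_of_tendsto hSp
        (h.mono fun k hk => hk.trans (envelope_le_s hp hp1 k)))
  refine ⟨p0, ⟨by linarith, by linarith, hzero⟩, fun q hq hq1 hSq => ?_, hneg, hpos, hl, hu⟩
  obtain h | h | h := lt_trichotomy q p0
  · exact absurd hSq (hneg q hq h).ne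
  · exact h
  · exact absurd hSq (hpos q h hq1).ne'
end
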